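/- arXiv:0905.3107 — 6 statements merged into one kernel-verified Lean document; each statement's English description precedes it below -/
import Mathlib

section
/- For every finite alphabet A of size n ≥ 2, every probability distribution p on A, and every real ε with 0 < ε < 1/2, there exists a binary prefix code C on A whose maximum codeword length is at most ⌈log₂ n⌉ + ⌈2·log₂(2/ε)⌉ and such that for every binary prefix code ψ on A, the expected codeword length of C under p is at most the expected codeword length of ψ under p plus ε. -/
/-- A binary prefix code on an alphabet `A`: an injective assignment of binary
strings such that no codeword is a prefix of another character's codeword. -/
def IsPrefixCode {A : Type*} (C : A → List Bool) : Prop :=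
  Function.Injective C ∧ ∀ a b : A, a ≠ b → ¬ (C a <+: C b)

/-- Expected codeword length of the code `C` under the distribution `p`. -/
noncomputable def expLen {A : Type*} [Fintype A] (p : A → ℝ) (C : A → List Bool) : ℝ :=
  ∑ a, p a * (C a).length

lemma not_append_prefix_append {α : Type*} {r r' : List α} (h : ¬ r <+: r') (h' : ¬ r' <+: r)
    (s t : List α) : ¬ (r ++ s <+: r' ++ t) := fun hp =>
  (List.prefix_or_prefix_of_prefix ((List.prefix_append r s).trans hp)
    (List.prefix_append r' t)).elim h h'

lemma isPrefixCode_of_not_prefix {A : Type*} {C : A → List Bool}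
    (h : ∀ a b : A, a ≠ b → ¬ (C a <+: C b)) : IsPrefixCode C :=
  ⟨fun a b hab => by
    by_contra hne
    exact h a b hne (hab ▸ List.prefix_refl _), h⟩

/-- The total probability of the characters whose codeword extends `v`. -/
noncomputable def weightBelow {A : Type*} [Fintype A] (p : A → ℝ) (C : A → List Bool)
    (v : List Bool) : ℝ :=
  ∑ a, if v <+: C a then p a else 0

/-- Exchange the subtrees of a code tree rooted at `s` and `u`. -/
def swapSubtrees {A : Type*} (C : A → List Bool) (s u : List Bool) (a : A) : List Bool :=
  if s <+: C a then u ++ (C a).drop s.length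
  else if u <+: C a then s ++ (C a).drop u.length
  else C a

lemma isPrefixCode_swapSubtrees {A : Type*} {C : A → List Bool} (hC : IsPrefixCode C)
    {s u : List Bool} (hsu : ¬ s <+: u) (hus : ¬ u <+: s)
    (hs : ∀ a, C a <+: s → C a = s) (hu : ∀ a, C a <+: u → C a = u) :
    IsPrefixCode (swapSubtrees C s u) := by
  have key : ∀ a, (∃ t, C a = s ++ t ∧ swapSubtrees C s u a = u ++ t) ∨
      (∃ t, C a = u ++ t ∧ swapSubtrees C s u a = s ++ t) ∨
      (swapSubtrees C s u a = C a ∧ ¬ s <+: C a ∧ ¬ u <+: C a ∧ ¬ C a <+: s ∧ ¬ C a <+: u) := by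
    intro a
    by_cases h1 : s <+: C a
    · obtain ⟨t, ht⟩ := h1
      exact .inl ⟨t, ht.symm, by simp [swapSubtrees, ← ht]⟩
    · by_cases h2 : u <+: C a
      · have h1' := h1
        obtain ⟨t, ht⟩ := h2
        refine .inr (.inl ⟨t, ht.symm, ?_⟩)
        rw [← ht] at h1'
        simp [swapSubtrees, ← ht, h1']
      · refine .inr (.inr ⟨by simp [swapSubtrees, h1, h2], h1, h2, fun h => ?_, fun h => ?_⟩)
        · exact h1 (hs a h ▸ List.prefix_refl _)
        · exact h2 (hu a h ▸ List.prefix_refl _)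
  refine isPrefixCode_of_not_prefix fun a b hab => ?_
  have hp := hC.2 a b hab
  rcases key a with ⟨t, h1, h2⟩ | ⟨t, h1, h2⟩ | ⟨h2, h3, h4, h5, h6⟩ <;>
  rcases key b with ⟨t', h1', h2'⟩ | ⟨t', h1', h2'⟩ | ⟨h2', h3', h4', h5', h6'⟩ <;>
  rw [h2, h2']
  · rw [h1, h1', List.prefix_append_right_inj] at hp
    rwa [List.prefix_append_right_inj]
  · exact not_append_prefix_append hus hsu _ _
  · simpa using not_append_prefix_append h4' h6' t []
  · exact not_append_prefix_append hsu hus _ _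
  · rw [h1, h1', List.prefix_append_right_inj] at hp
    rwa [List.prefix_append_right_inj]
  · simpa using not_append_prefix_append h3' h5' t []
  · simpa using not_append_prefix_append h6 h4 [] t'
  · simpa using not_append_prefix_append h5 h3 [] t'
  · exact hp

lemma expLen_swapSubtrees {A : Type*} [Fintype A] (p : A → ℝ) (C : A → List Bool)
    {s u : List Bool} (hsu : ¬ s <+: u) (hus : ¬ u <+: s) (hlen : u.length = s.length + 1) :
    expLen p (swapSubtrees C s u) = expLen p C + weightBelow p C s - weightBelow p C u := by
  unfold expLen weightBelow
  rw [← Finset.sum_add_distrib, ← Finset.sum_sub_distrib]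
  refine Finset.sum_congr rfl fun a _ => ?_
  by_cases h1 : s <+: C a
  · have h2 : ¬ u <+: C a := fun h2 => (List.prefix_or_prefix_of_prefix h1 h2).elim hsu hus
    obtain ⟨t, ht⟩ := h1
    simp only [swapSubtrees, ← ht, List.prefix_append, if_true, List.drop_left,
      List.length_append, hlen]
    rw [if_neg (by rwa [ht])]
    push_cast
    ring
  · by_cases h2 : u <+: C a
    · obtain ⟨t, ht⟩ := h2
      rw [← ht] at h1
      simp only [swapSubtrees, if_neg h1, ← ht, List.prefix_append, if_true, List.drop_left]
      simp only [List.length_append, hlen]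
      push_cast
      ring
    · simp [swapSubtrees, h1, h2]

/-- Below the node `v`, make room for a subtree holding all characters with long codewords. -/
def regraft {A : Type*} (C : A → List Bool) (v : List Bool) (L : ℕ) (e : A → List Bool) (a : A) :
    List Bool :=
  if L ≤ (C a).length then v ++ true :: e a
  else if v <+: C a then v ++ false :: (C a).drop v.length
  else C a

lemma isPrefixCode_regraft {A : Type*} {C : A → List Bool} (hC : IsPrefixCode C)
    {v : List Bool} {L : ℕ} {e : A → List Bool} (he : IsPrefixCode e) (hv : ∀ a, C a <+: v → C a = v) :
    IsPrefixCode (regraft C v L e) := by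
  have key : ∀ a, regraft C v L e a = v ++ true :: e a ∨
      (∃ t, C a = v ++ t ∧ regraft C v L e a = v ++ false :: t) ∨
      (regraft C v L e a = C a ∧ ¬ v <+: C a ∧ ¬ C a <+: v) := by
    intro a
    by_cases h1 : L ≤ (C a).length
    · exact .inl (by simp [regraft, h1])
    · by_cases h2 : v <+: C a
      · refine .inr (.inl ⟨(C a).drop v.length, ?_, by simp [regraft, h1, h2]⟩)
        obtain ⟨t, ht⟩ := h2
        simp [← ht]
      · exact .inr (.inr ⟨by simp [regraft, h1, h2], h2,
          fun h => h2 (hv a h ▸ List.prefix_refl _)⟩)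
  refine isPrefixCode_of_not_prefix fun a b hab => ?_
  have hp := hC.2 a b hab
  rcases key a with h2 | ⟨t, h1, h2⟩ | ⟨h2, h3, h4⟩ <;>
  rcases key b with h2' | ⟨t', h1', h2'⟩ | ⟨h2', h3', h4'⟩ <;>
  rw [h2, h2']
  · simpa [List.prefix_append_right_inj] using he.2 a b hab
  · simp [List.prefix_append_right_inj]
  · simpa using not_append_prefix_append h3' h4' (true :: e a) []
  · simp [List.prefix_append_right_inj]
  · rw [h1, h1', List.prefix_append_right_inj] at hp
    simpa [List.prefix_append_right_inj] using hp
  · simpa using not_append_prefix_append h3' h4' (false :: t) []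
  · simpa using not_append_prefix_append h4 h3 [] (true :: e b)
  · simpa using not_append_prefix_append h4 h3 [] (false :: t')
  · exact hp

lemma length_regraft_le {A : Type*} {C : A → List Bool} {v : List Bool} {L : ℕ}
    {e : A → List Bool}
    (hL : ∀ a, v.length + 1 + (e a).length ≤ L) (a : A) : (regraft C v L e a).length ≤ L := by
  have := hL a
  unfold regraft
  split_ifs with h1 h2
  · simp
    omega
  · have := h2.length_le
    simp
    omega
  · omega

/-- Codes with minimal expected length exist: length vectors are partially well-ordered. -/
lemma exists_optimal_code {A : Type*} [Fintype A] (p : A → ℝ) (hp0 : ∀ a, 0 ≤ p a)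
    (hne : ∃ C : A → List Bool, IsPrefixCode C) :
    ∃ C : A → List Bool, IsPrefixCode C ∧ ∀ ψ, IsPrefixCode ψ → expLen p C ≤ expLen p ψ := by
  let f : (A → ℕ) → ℝ := fun l => ∑ a, p a * (l a : ℝ)
  have hf : Monotone f := fun l l' h => Finset.sum_le_sum fun a _ =>
    mul_le_mul_of_nonneg_left (by exact_mod_cast h a) (hp0 a)
  let S : Set (A → ℕ) := {l | ∃ C : A → List Bool, IsPrefixCode C ∧ l = fun a => (C a).length}
  have hW : (f '' S).IsWF := ((Set.isPWO_of_wellQuasiOrderedLE S).image_of_monotone hf).isWF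
  have hN : (f '' S).Nonempty := by
    obtain ⟨C, hC⟩ := hne
    exact ⟨_, _, ⟨C, hC, rfl⟩, rfl⟩
  obtain ⟨_, ⟨C, hC, rfl⟩, hmin⟩ := hW.min_mem hN
  refine ⟨C, hC, fun ψ hψ => ?_⟩
  have h := hW.min_le hN ⟨_, ⟨ψ, hψ, rfl⟩, rfl⟩
  rw [← hmin] at h
  exact h

section Optimal

variable {A : Type*} [Fintype A] {p : A → ℝ} {C : A → List Bool}

lemma weightBelow_le_of_optimal (hC : IsPrefixCode C)
    (hopt : ∀ ψ, IsPrefixCode ψ → expLen p C ≤ expLen p ψ) {x : List Bool} {b c : Bool} {d : A}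
    (hd : x ++ [b, c] <+: C d) :
    weightBelow p C (x ++ [b, c]) ≤ weightBelow p C (x ++ [!b]) := by
  have hx : ∀ a, ¬ C a <+: x ++ [b] := by
    intro a ha
    have hxd : x ++ [b] <+: C d := List.IsPrefix.trans ⟨[c], by simp⟩ hd
    rcases eq_or_ne a d with rfl | hne
    · have h1 := hd.length_le
      have h2 := ha.length_le
      simp at h1 h2
      omega
    · exact hC.2 a d hne (ha.trans hxd)
  have hsu : ¬ x ++ [!b] <+: x ++ [b, c] := by
    rw [List.prefix_append_right_inj]
    simp
  have hus : ¬ x ++ [b, c] <+: x ++ [!b] := fun h => by simpa using h.length_le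
  have hlen : (x ++ [b, c]).length = (x ++ [!b]).length + 1 := by simp
  have h := hopt _ (isPrefixCode_swapSubtrees hC hsu hus
    (fun a ha => (List.prefix_concat_iff.1 ha).resolve_right fun h =>
      hx a (h.trans (List.prefix_append _ _)))
    (fun a ha => by
      rw [show x ++ [b, c] = (x ++ [b]) ++ [c] by simp] at ha ⊢
      exact (List.prefix_concat_iff.1 ha).resolve_right (hx a)))
  rw [expLen_swapSubtrees p C hsu hus hlen] at h
  linarith

lemma weightBelow_anti (hp0 : ∀ a, 0 ≤ p a) {u v : List Bool} (h : u <+: v) :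
    weightBelow p C v ≤ weightBelow p C u := by
  refine Finset.sum_le_sum fun a _ => ?_
  by_cases hv : v <+: C a
  · simp [hv, h.trans hv]
  · rw [if_neg hv]
    split_ifs
    exacts [hp0 a, le_rfl]

lemma weightBelow_children_le (hp0 : ∀ a, 0 ≤ p a) (x : List Bool) (b : Bool) :
    weightBelow p C (x ++ [b]) + weightBelow p C (x ++ [!b]) ≤ weightBelow p C x := by
  unfold weightBelow
  rw [← Finset.sum_add_distrib]
  refine Finset.sum_le_sum fun a _ => ?_
  by_cases hx : x <+: C a
  · rw [if_pos hx]
    by_cases h1 : x ++ [b] <+: C a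
    · have h2 : ¬ x ++ [!b] <+: C a := by
        obtain ⟨t, ht⟩ := h1
        rw [← ht, List.append_assoc, List.prefix_append_right_inj]
        simp
      simp [h1, h2]
    · rw [if_neg h1]
      split_ifs <;> simp [hp0 a]
  · have h1 : ∀ c, ¬ x ++ [c] <+: C a := fun c h => hx ((List.prefix_append _ _).trans h)
    simp [h1, hx]

lemma weightBelow_take_le_of_optimal (hp0 : ∀ a, 0 ≤ p a) (hp1 : ∑ a, p a = 1)
    (hC : IsPrefixCode C) (hopt : ∀ ψ, IsPrefixCode ψ → expLen p C ≤ expLen p ψ) (d : A) :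
    ∀ k, 2 * k ≤ (C d).length → weightBelow p C ((C d).take (2 * k)) ≤ 1 / 2 ^ k := by
  intro k
  induction k with
  | zero => simp [weightBelow, hp1]
  | succ k ih =>
    intro hk
    have ih := ih (by omega)
    set x := (C d).take (2 * k) with hx
    obtain ⟨b, c, hbc⟩ : ∃ b c, (C d).take (2 * (k + 1)) = x ++ [b, c] :=
      ⟨(C d)[2 * k], (C d)[2 * k + 1], by
        rw [show 2 * (k + 1) = 2 * k + 1 + 1 by ring,
          List.take_succ_eq_append_getElem (by omega),
          List.take_succ_eq_append_getElem (by omega), List.append_assoc]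
        rfl⟩
    rw [hbc]
    have h1 := weightBelow_le_of_optimal (p := p) hC hopt (hbc ▸ List.take_prefix _ (C d))
    have h2 := weightBelow_children_le (C := C) hp0 x b
    have h3 := weightBelow_anti (C := C) hp0 (u := x ++ [b]) (v := x ++ [b, c]) ⟨[c], by simp⟩
    have h4 : (1 : ℝ) / 2 ^ (k + 1) = 1 / 2 ^ k / 2 := by rw [pow_succ]; field_simp
    rw [h4]
    linarith

lemma expLen_regraft_le (hp0 : ∀ a, 0 ≤ p a) {v : List Bool} {L : ℕ} {e : A → List Bool}
    (hL : ∀ a, v.length + 1 + (e a).length ≤ L) :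
    expLen p (regraft C v L e) ≤ expLen p C + weightBelow p C v := by
  unfold expLen weightBelow
  rw [← Finset.sum_add_distrib]
  refine Finset.sum_le_sum fun a _ => ?_
  have hlen : (regraft C v L e a).length ≤ (C a).length + if v <+: C a then 1 else 0 := by
    have := hL a
    unfold regraft
    split_ifs with h1 h2 h2
    · simp
      omega
    · simp
      omega
    · have := h2.length_le
      simp
      omega
    · simp
  have h := mul_le_mul_of_nonneg_left (Nat.cast_le (α := ℝ).2 hlen) (hp0 a)
  refine h.trans_eq ?_
  split_ifs <;> push_cast <;> ring

end Optimal

lemma exists_fixed_length_code {A : Type*} [Fintype A] {K : ℕ} (hK : Fintype.card A ≤ 2 ^ K) :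
    ∃ e : A → List Bool, IsPrefixCode e ∧ ∀ a, (e a).length = K := by
  obtain ⟨g⟩ := Function.Embedding.nonempty_of_card_le (α := A) (β := Fin K → Bool) (by simpa)
  refine ⟨fun a => List.ofFn (g a), isPrefixCode_of_not_prefix fun a b hab h => hab ?_, by simp⟩
  exact g.injective (List.ofFn_injective (h.eq_of_length (by simp)))

lemma exists_length_limited_code {A : Type*} [Fintype A] {p : A → ℝ} (hp0 : ∀ a, 0 ≤ p a)
    (hp1 : ∑ a, p a = 1) {K : ℕ} (hK : Fintype.card A ≤ 2 ^ K) (k : ℕ) :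
    ∃ C : A → List Bool, IsPrefixCode C ∧ (∀ a, (C a).length ≤ 2 * k + 1 + K) ∧
      ∀ ψ, IsPrefixCode ψ → expLen p C ≤ expLen p ψ + 1 / 2 ^ k := by
  obtain ⟨e, he, hlen⟩ := exists_fixed_length_code hK
  obtain ⟨C, hC, hopt⟩ := exists_optimal_code p hp0 ⟨e, he⟩
  by_cases hshort : ∀ a, (C a).length ≤ 2 * k + 1 + K
  · refine ⟨C, hC, hshort, fun ψ hψ => (hopt ψ hψ).trans ?_⟩
    have : (0 : ℝ) ≤ 1 / 2 ^ k := by positivity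
    linarith
  · push Not at hshort
    obtain ⟨d, hd⟩ := hshort
    have hL : ∀ a, ((C d).take (2 * k)).length + 1 + (e a).length ≤ 2 * k + 1 + K := by
      intro a
      rw [hlen, List.length_take]
      omega
    have hv : ∀ a, C a <+: (C d).take (2 * k) → C a = (C d).take (2 * k) := by
      intro a ha
      rcases eq_or_ne a d with rfl | hne
      · have := ha.length_le
        rw [List.length_take] at this
        omega
      · exact absurd (ha.trans (List.take_prefix _ _)) (hC.2 a d hne)
    refine ⟨regraft C ((C d).take (2 * k)) (2 * k + 1 + K) e, isPrefixCode_regraft hC he hv,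
      length_regraft_le hL, fun ψ hψ => ?_⟩
    have h1 := expLen_regraft_le (C := C) hp0 hL
    have h2 := weightBelow_take_le_of_optimal hp0 hp1 hC hopt d k (by omega)
    have h3 := hopt ψ hψ
    linarith

theorem stmt0 {A : Type*} [Fintype A] (n : ℕ) (hn : 2 ≤ n) (hcard : Fintype.card A = n)
    (p : A → ℝ) (hp0 : ∀ a, 0 ≤ p a) (hp1 : ∑ a, p a = 1)
    (ε : ℝ) (hε0 : 0 < ε) (hε1 : ε < 1 / 2) :
    ∃ C : A → List Bool, IsPrefixCode C ∧
      (∀ a, ((C a).length : ℤ) ≤ ⌈Real.logb 2 n⌉ + ⌈2 * Real.logb 2 (2 / ε)⌉) ∧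
      (∀ ψ : A → List Bool, IsPrefixCode ψ → expLen p C ≤ expLen p ψ + ε) := by
  have hn0 : (0 : ℝ) < n := by positivity
  have hlog : 0 ≤ Real.logb 2 n :=
    Real.logb_nonneg (by norm_num) (by exact_mod_cast (by omega : 1 ≤ n))
  obtain ⟨K, hK⟩ := Int.eq_ofNat_of_zero_le (Int.ceil_nonneg hlog)
  have hnK : Fintype.card A ≤ 2 ^ K := by
    have h := Int.le_ceil (Real.logb 2 n)
    rw [hK, Int.cast_natCast, Real.logb_le_iff_le_rpow (by norm_num) hn0, Real.rpow_natCast] at h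
    rw [hcard]
    exact_mod_cast h
  have hlogε : 2 < Real.logb 2 (2 / ε) := by
    rw [Real.lt_logb_iff_rpow_lt (by norm_num) (by positivity), lt_div_iff₀ hε0]
    norm_num
    linarith
  obtain ⟨D, hD⟩ := Int.eq_ofNat_of_zero_le
    (Int.ceil_nonneg (by linarith : 0 ≤ 2 * Real.logb 2 (2 / ε)))
  have hDle : 2 * Real.logb 2 (2 / ε) ≤ D := by
    have h := Int.le_ceil (2 * Real.logb 2 (2 / ε))
    rwa [hD, Int.cast_natCast] at h
  have hD1 : 1 ≤ D := by
    have : (1 : ℝ) ≤ D := by linarith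
    exact_mod_cast this
  obtain ⟨k, hk1, hk2⟩ : ∃ k, 2 * k + 1 ≤ D ∧ D ≤ 2 * k + 2 := ⟨(D - 1) / 2, by omega, by omega⟩
  have hkε : 1 / 2 ^ k ≤ ε := by
    have hk2' : (D : ℝ) ≤ 2 * k + 2 := by exact_mod_cast hk2
    have h : Real.logb 2 (2 / ε) ≤ (k + 1 : ℕ) := by
      push_cast
      linarith
    rw [Real.logb_le_iff_le_rpow (by norm_num) (by positivity), Real.rpow_natCast,
      div_le_iff₀ hε0, pow_succ] at h
    rw [div_le_iff₀ (by positivity)]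
    linarith
  obtain ⟨C, hC, hlen, hopt⟩ := exists_length_limited_code hp0 hp1 hnK k
  refine ⟨C, hC, fun a => ?_, fun ψ hψ => (hopt ψ hψ).trans (by linarith)⟩
  rw [hK, hD]
  have := hlen a
  omega
end

section
/- Let φ = (1+√5)/2 denote the golden ratio. For every finite alphabet A of size n ≥ 2, every probability distribution p on A, and every integer L ≥ ⌈log₂ n⌉ + 1, there exists a binary prefix code C on A whose maximum codeword length is at most L and such that for every binary prefix code ψ on A, the expected codeword length of C under p is at most the expected codeword length of ψ under p plus φ^{−(L − ⌈log₂ n⌉ − 1)}. -/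
/-- The finite set of binary strings of length `N`. -/
def binaryStrings (N : ℕ) : Finset (List Bool) :=
  (Finset.univ : Finset (Fin N → Bool)).image List.ofFn

lemma card_binaryStrings (N : ℕ) : (binaryStrings N).card = 2 ^ N := by
  rw [binaryStrings, Finset.card_image_of_injective _ List.ofFn_injective]
  simp

lemma mem_binaryStrings {N : ℕ} {w : List Bool} : w ∈ binaryStrings N ↔ w.length = N := by
  simp only [binaryStrings, Finset.mem_image, Finset.mem_univ, true_and]
  constructor
  · rintro ⟨f, rfl⟩
    simp
  · rintro rfl
    exact ⟨w.get, List.ofFn_get w⟩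

/-- The strings of length `N` extending `u`. -/
def extensions (N : ℕ) (u : List Bool) : Finset (List Bool) :=
  (binaryStrings (N - u.length)).image (u ++ ·)

lemma card_extensions (N : ℕ) (u : List Bool) :
    (extensions N u).card = 2 ^ (N - u.length) := by
  rw [extensions, Finset.card_image_of_injective _ (List.append_right_injective u),
    card_binaryStrings]

lemma mem_extensions {N : ℕ} {u w : List Bool} (hu : u.length ≤ N) :
    w ∈ extensions N u ↔ u <+: w ∧ w.length = N := by
  simp only [extensions, Finset.mem_image, mem_binaryStrings]
  constructor
  · rintro ⟨v, hv, rfl⟩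
    refine ⟨List.prefix_append _ _, ?_⟩
    rw [List.length_append]
    omega
  · rintro ⟨⟨v, rfl⟩, hw⟩
    refine ⟨v, ?_, rfl⟩
    rw [List.length_append] at hw
    omega

lemma cast_sum_two_pow_sub {A : Type*} {S : Finset A} {l : A → ℕ} {N : ℕ}
    (hN : ∀ a ∈ S, l a ≤ N) :
    ((∑ a ∈ S, 2 ^ (N - l a) : ℕ) : ℝ) = 2 ^ N * ∑ a ∈ S, (1 / 2 : ℝ) ^ l a := by
  push_cast
  rw [Finset.mul_sum]
  refine Finset.sum_congr rfl fun a ha => ?_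
  rw [pow_sub₀ _ two_ne_zero (hN a ha), one_div, inv_pow]

/-- Kraft's inequality for prefix codes. -/
lemma IsPrefixCode.kraft {A : Type*} [Fintype A] {C : A → List Bool} (hC : IsPrefixCode C) :
    ∑ a, (1 / 2 : ℝ) ^ (C a).length ≤ 1 := by
  classical
  set N := Finset.univ.sup fun a => (C a).length
  have hN : ∀ a, (C a).length ≤ N := fun a =>
    Finset.le_sup (f := fun a => (C a).length) (Finset.mem_univ a)
  have hdisj : ((Finset.univ : Finset A) : Set A).PairwiseDisjoint
      fun a => extensions N (C a) := by
    intro a _ b _ hab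
    refine Finset.disjoint_left.2 fun w hwa hwb => ?_
    rw [mem_extensions (hN _)] at hwa hwb
    rcases List.prefix_or_prefix_of_prefix hwa.1 hwb.1 with h | h
    · exact hC.2 a b hab h
    · exact hC.2 b a hab.symm h
  have hcard : ∑ a, 2 ^ (N - (C a).length) ≤ 2 ^ N := by
    rw [← card_binaryStrings N, ← Finset.sum_congr rfl fun a _ => card_extensions N (C a),
      ← Finset.card_biUnion hdisj]
    refine Finset.card_le_card fun w hw => ?_
    obtain ⟨a, -, ha⟩ := Finset.mem_biUnion.1 hw
    exact mem_binaryStrings.2 ((mem_extensions (hN a)).1 ha).2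
  have hcast : ((∑ a, 2 ^ (N - (C a).length) : ℕ) : ℝ) ≤ 2 ^ N := by exact_mod_cast hcard
  rw [cast_sum_two_pow_sub fun a _ => hN a] at hcast
  exact le_of_mul_le_mul_left (by simpa using hcast) (by positivity : (0 : ℝ) < 2 ^ N)

/-- Lengths satisfying Kraft's inequality on a finite set are realized by a prefix-free family. -/
lemma exists_prefixFree_of_kraft {A : Type*} (l : A → ℕ) (S : Finset A)
    (hS : ∑ a ∈ S, (1 / 2 : ℝ) ^ l a ≤ 1) :
    ∃ C : A → List Bool, (∀ a ∈ S, (C a).length = l a) ∧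
      ∀ a ∈ S, ∀ b ∈ S, a ≠ b → ¬ (C a <+: C b) := by
  classical
  induction S using Finset.induction_on_max_value l with
  | empty => exact ⟨fun _ => [], by simp⟩
  | insert a S ha hmax ih =>
    rw [Finset.sum_insert ha] at hS
    have hpos : (0 : ℝ) < (1 / 2) ^ l a := by positivity
    obtain ⟨C, hlen, hpre⟩ := ih (by linarith)
    have hcast := cast_sum_two_pow_sub hmax
    have hlt : ∑ b ∈ S, 2 ^ (l a - l b) < 2 ^ l a := by
      have h : ((∑ b ∈ S, 2 ^ (l a - l b) : ℕ) : ℝ) < 2 ^ l a := by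
        rw [hcast]
        exact mul_lt_of_lt_one_right (by positivity) (by linarith)
      exact_mod_cast h
    have hcard : (S.biUnion fun b => extensions (l a) (C b)).card < (binaryStrings (l a)).card := by
      refine Finset.card_biUnion_le.trans_lt ?_
      rw [card_binaryStrings]
      refine lt_of_eq_of_lt (Finset.sum_congr rfl fun b hb => ?_) hlt
      rw [card_extensions, hlen b hb]
    obtain ⟨w, hw, hwS⟩ := Finset.exists_mem_notMem_of_card_lt_card hcard
    rw [mem_binaryStrings] at hw
    have hnew : ∀ b ∈ S, ¬ (C b <+: w) := fun b hb h =>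
      hwS (Finset.mem_biUnion.2
        ⟨b, hb, (mem_extensions (by rw [hlen b hb]; exact hmax b hb)).2 ⟨h, hw⟩⟩)
    have hnew' : ∀ b ∈ S, ¬ (w <+: C b) := by
      intro b hb h
      have h1 : w = C b := h.eq_of_length_le (by rw [hlen b hb, hw]; exact hmax b hb)
      exact hnew b hb (h1 ▸ List.prefix_rfl)
    have hne : ∀ b ∈ S, b ≠ a := fun b hb h => ha (h ▸ hb)
    refine ⟨Function.update C a w, ?_, ?_⟩
    · intro b hb
      rcases Finset.mem_insert.1 hb with rfl | hb
      · simpa using hw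
      · rw [Function.update_of_ne (hne b hb)]
        exact hlen b hb
    · intro b hb c hc hbc
      rcases Finset.mem_insert.1 hb with rfl | hb' <;>
        rcases Finset.mem_insert.1 hc with rfl | hc'
      · exact absurd rfl hbc
      · rw [Function.update_self, Function.update_of_ne (hne c hc')]
        exact hnew' c hc'
      · rw [Function.update_self, Function.update_of_ne (hne b hb')]
        exact hnew b hb'
      · rw [Function.update_of_ne (hne b hb'), Function.update_of_ne (hne c hc')]
        exact hpre b hb' c hc' hbc

lemma exists_isPrefixCode_of_kraft {A : Type*} [Fintype A] (l : A → ℕ)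
    (hl : ∑ a, (1 / 2 : ℝ) ^ l a ≤ 1) :
    ∃ C : A → List Bool, IsPrefixCode C ∧ ∀ a, (C a).length = l a := by
  obtain ⟨C, hlen, hpre⟩ := exists_prefixFree_of_kraft l Finset.univ hl
  have hpre' : ∀ a b, a ≠ b → ¬ (C a <+: C b) := fun a b =>
    hpre a (Finset.mem_univ a) b (Finset.mem_univ b)
  refine ⟨C, ⟨fun a b hab => ?_, hpre'⟩, fun a => hlen a (Finset.mem_univ a)⟩
  by_contra hne
  exact hpre' a b hne (hab ▸ List.prefix_rfl)

lemma sum_half_pow_add_le {A : Type*} {S : Finset A} {l : A → ℕ} {N k : ℕ}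
    (hN : ∀ a ∈ S, l a ≤ N) (hk : k ≤ N) (hlt : ∑ a ∈ S, (1 / 2 : ℝ) ^ l a < (1 / 2) ^ k) :
    ∑ a ∈ S, (1 / 2 : ℝ) ^ l a + (1 / 2) ^ N ≤ (1 / 2) ^ k := by
  have hcast := cast_sum_two_pow_sub hN
  have h2 : (0 : ℝ) < 2 ^ N := by positivity
  have hk' : ((2 ^ (N - k) : ℕ) : ℝ) = 2 ^ N * (1 / 2) ^ k := by
    push_cast
    rw [pow_sub₀ _ two_ne_zero hk, one_div, inv_pow]
  have hN' : (2 : ℝ) ^ N * (1 / 2) ^ N = 1 := by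
    rw [← mul_pow]
    norm_num
  have hnat : ∑ a ∈ S, 2 ^ (N - l a) < 2 ^ (N - k) := by
    rw [← Nat.cast_lt (α := ℝ), hcast, hk']
    exact mul_lt_mul_of_pos_left hlt h2
  have hle : ((∑ a ∈ S, 2 ^ (N - l a) : ℕ) : ℝ) + 1 ≤ ((2 ^ (N - k) : ℕ) : ℝ) := by
    exact_mod_cast hnat
  rw [hcast, hk'] at hle
  refine le_of_mul_le_mul_left ?_ h2
  rw [mul_add, hN']
  exact hle

/-- A family of dyadic masses, each at most `2⁻ᵏ`, of total mass at least `2⁻ᵏ` has a subfamily of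
mass exactly `2⁻ᵏ`. -/
lemma exists_subset_sum_half_pow_eq {A : Type*} (l : A → ℕ) (k : ℕ) (S : Finset A)
    (hk : ∀ a ∈ S, k ≤ l a) (hS : (1 / 2 : ℝ) ^ k ≤ ∑ a ∈ S, (1 / 2 : ℝ) ^ l a) :
    ∃ T ⊆ S, ∑ a ∈ T, (1 / 2 : ℝ) ^ l a = (1 / 2) ^ k := by
  classical
  induction S using Finset.induction_on_max_value l with
  | empty =>
    have : (0 : ℝ) < (1 / 2) ^ k := by positivity
    rw [Finset.sum_empty] at hS
    linarith
  | insert a S ha hmax ih =>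
    rcases le_or_gt ((1 / 2 : ℝ) ^ k) (∑ a ∈ S, (1 / 2 : ℝ) ^ l a) with h | h
    · obtain ⟨T, hT, hT'⟩ := ih (fun b hb => hk b (Finset.mem_insert_of_mem hb)) h
      exact ⟨T, hT.trans (Finset.subset_insert a S), hT'⟩
    · have := sum_half_pow_add_le hmax (hk a (Finset.mem_insert_self a S)) h
      refine ⟨insert a S, subset_rfl, le_antisymm ?_ hS⟩
      rw [Finset.sum_insert ha]
      linarith

/-- A monotone function on a well-quasi-order attains its minimum on every nonempty set. -/
lemma Monotone.exists_forall_le_of_wellQuasiOrderedLE {α β : Type*} [Preorder α]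
    [WellQuasiOrderedLE α] [LinearOrder β] {f : α → β} (hf : Monotone f) {s : Set α}
    (hs : s.Nonempty) : ∃ x ∈ s, ∀ y ∈ s, f x ≤ f y := by
  have hwf : WellFounded fun x y : α => f x < f y := by
    rw [wellFounded_iff_isEmpty_descending_chain]
    refine ⟨fun ⟨g, hg⟩ => ?_⟩
    obtain ⟨i, j, hij, hle⟩ := wellQuasiOrdered_le g
    have hanti : StrictAnti (f ∘ g) := strictAnti_nat_of_succ_lt hg
    exact (hanti hij).not_ge (hf hle)
  obtain ⟨x, hx, hmin⟩ := hwf.has_min s hs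
  exact ⟨x, hx, fun y hy => not_lt.1 (hmin y hy)⟩

/-- Among length functions satisfying Kraft's inequality there is one of least cost, and it can be
chosen to satisfy Kraft's inequality with equality. -/
lemma exists_optimal_lengths {A : Type*} [Fintype A] [Nonempty A] (p : A → ℝ)
    (hp : ∀ a, 0 ≤ p a) :
    ∃ l : A → ℕ, ∑ a, (1 / 2 : ℝ) ^ l a = 1 ∧
      ∀ l' : A → ℕ, ∑ a, (1 / 2 : ℝ) ^ l' a ≤ 1 → ∑ a, p a * l a ≤ ∑ a, p a * l' a := by
  classical
  have hmono : Monotone fun l : A → ℕ => toLex (∑ a, p a * (l a : ℝ), ∑ a, l a) := by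
    intro l l' h
    exact Prod.Lex.toLex_mono (Prod.mk_le_mk.2
      ⟨Finset.sum_le_sum fun a _ => mul_le_mul_of_nonneg_left (Nat.cast_le.2 (h a)) (hp a),
        Finset.sum_le_sum fun a _ => h a⟩)
  have hne : {l : A → ℕ | ∑ a, (1 / 2 : ℝ) ^ l a ≤ 1}.Nonempty := by
    refine ⟨fun _ => Fintype.card A, ?_⟩
    have h : (Fintype.card A : ℝ) ≤ 2 ^ Fintype.card A := by
      exact_mod_cast Nat.lt_two_pow_self.le
    simp only [Set.mem_ofPred_eq, Finset.sum_const, Finset.card_univ, nsmul_eq_mul, one_div, inv_pow]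
    rw [← div_eq_mul_inv]
    exact div_le_one_of_le₀ h (by positivity)
  obtain ⟨l, hl, hmin⟩ := hmono.exists_forall_le_of_wellQuasiOrderedLE hne
  have hmin' : ∀ l' : A → ℕ, ∑ a, (1 / 2 : ℝ) ^ l' a ≤ 1 →
      ∑ a, p a * l a < ∑ a, p a * l' a ∨
        ∑ a, p a * l a = ∑ a, p a * l' a ∧ ∑ a, l a ≤ ∑ a, l' a := fun l' hl' => by
    simpa [Prod.Lex.toLex_le_toLex] using hmin l' hl'
  refine ⟨l, ?_, fun l' hl' => (hmin' l' hl').elim le_of_lt fun h => h.1.le⟩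
  by_contra hne1
  have hlt : ∑ a, (1 / 2 : ℝ) ^ l a < (1 / 2) ^ 0 := by
    rw [pow_zero]
    exact lt_of_le_of_ne hl hne1
  obtain ⟨a, -, hmax⟩ := Finset.exists_max_image Finset.univ l Finset.univ_nonempty
  have hadd := sum_half_pow_add_le hmax (Nat.zero_le _) hlt
  have ha : 0 < l a := by
    refine Nat.pos_of_ne_zero fun h0 => hlt.not_ge ?_
    rw [show (1 / 2 : ℝ) ^ 0 = (1 / 2) ^ l a by rw [h0]]
    exact Finset.single_le_sum (f := fun a => (1 / 2 : ℝ) ^ l a) (fun b _ => by positivity)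
      (Finset.mem_univ a)
  set l' : A → ℕ := fun b => if b = a then l b - 1 else l b with hl'def
  have hle : ∀ b, l' b ≤ l b := fun b => by
    simp only [hl'def]
    split_ifs <;> omega
  have hsum : ∑ b, (1 / 2 : ℝ) ^ l' b ≤ 1 := by
    have h : ∀ b, (1 / 2 : ℝ) ^ l' b = (1 / 2) ^ l b + if b = a then (1 / 2) ^ l a else 0 := by
      intro b
      simp only [hl'def]
      split_ifs with hb
      · subst hb
        obtain ⟨k, hk⟩ := Nat.exists_eq_succ_of_ne_zero ha.ne'
        rw [hk, Nat.succ_sub_one, pow_succ]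
        ring
      · rw [add_zero]
    rw [Finset.sum_congr rfl fun b _ => h b, Finset.sum_add_distrib, Finset.sum_ite_eq']
    simpa using hadd
  have hcost : ∑ b, p b * (l' b : ℝ) ≤ ∑ b, p b * (l b : ℝ) :=
    Finset.sum_le_sum fun b _ =>
      mul_le_mul_of_nonneg_left (by exact_mod_cast hle b) (hp b)
  have hslt : ∑ b, l' b < ∑ b, l b :=
    Finset.sum_lt_sum (fun b _ => hle b) ⟨a, Finset.mem_univ a, by simp [hl'def, ha]⟩
  rcases hmin' l' hsum with h | h
  · linarith
  · omega

/-- In an optimal length function a set of Kraft mass `2⁻⁽ⁱ⁺¹⁾` weighs at least as much as a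
disjoint set of Kraft mass `2⁻⁽ⁱ⁺²⁾`. -/
lemma sum_le_sum_of_optimal {A : Type*} [Fintype A] {p : A → ℝ} {l : A → ℕ}
    (hl : ∑ a, (1 / 2 : ℝ) ^ l a ≤ 1)
    (hopt : ∀ l' : A → ℕ, ∑ a, (1 / 2 : ℝ) ^ l' a ≤ 1 → ∑ a, p a * l a ≤ ∑ a, p a * l' a)
    {T V : Finset A} (hTV : Disjoint T V) {i : ℕ}
    (hT : ∑ a ∈ T, (1 / 2 : ℝ) ^ l a = (1 / 2) ^ (i + 1))
    (hV : ∑ a ∈ V, (1 / 2 : ℝ) ^ l a = (1 / 2) ^ (i + 2)) :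
    ∑ a ∈ V, p a ≤ ∑ a ∈ T, p a := by
  classical
  have hpos : ∀ a ∈ V, 0 < l a := by
    intro a ha
    refine Nat.pos_of_ne_zero fun h0 => ?_
    have h1 := Finset.single_le_sum (f := fun a => (1 / 2 : ℝ) ^ l a) (fun b _ => by positivity) ha
    have h2 : (1 / 2 : ℝ) ^ (i + 2) < 1 := pow_lt_one₀ (by norm_num) (by norm_num) (by omega)
    simp only [h0, pow_zero] at h1
    linarith
  set l' : A → ℕ := fun a => if a ∈ T then l a + 1 else if a ∈ V then l a - 1 else l a with hl'
  have hsum : ∑ a, (1 / 2 : ℝ) ^ l' a ≤ 1 := by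
    have h : ∀ a, (1 / 2 : ℝ) ^ l' a = (1 / 2) ^ l a
        + ((if a ∈ V then (1 / 2) ^ l a else 0) - (if a ∈ T then (1 / 2) ^ l a else 0) / 2) := by
      intro a
      simp only [hl']
      by_cases haT : a ∈ T
      · simp only [haT, Finset.disjoint_left.1 hTV haT, if_true, if_false, pow_succ]
        ring
      · by_cases haV : a ∈ V
        · obtain ⟨k, hk⟩ := Nat.exists_eq_succ_of_ne_zero (hpos a haV).ne'
          simp only [haT, haV, if_true, if_false, hk, Nat.succ_sub_one, pow_succ]
          ring
        · simp [haT, haV]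
    rw [Finset.sum_congr rfl fun a _ => h a, Finset.sum_add_distrib, Finset.sum_sub_distrib,
      ← Finset.sum_div, Finset.sum_ite_mem, Finset.sum_ite_mem, Finset.univ_inter,
      Finset.univ_inter, hT, hV, pow_succ, pow_succ]
    linarith
  have hcost := hopt l' hsum
  have h : ∀ a, p a * (l' a : ℝ) = p a * l a
      + ((if a ∈ T then p a else 0) - (if a ∈ V then p a else 0)) := by
    intro a
    simp only [hl']
    by_cases haT : a ∈ T
    · simp only [haT, Finset.disjoint_left.1 hTV haT, if_true, if_false]
      push_cast
      ring
    · by_cases haV : a ∈ V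
      · simp only [haT, haV, if_true, if_false]
        rw [Nat.cast_sub (hpos a haV)]
        push_cast
        ring
      · simp [haT, haV]
  rw [Finset.sum_congr rfl fun a _ => h a, Finset.sum_add_distrib, Finset.sum_sub_distrib,
    Finset.sum_ite_mem, Finset.sum_ite_mem, Finset.univ_inter, Finset.univ_inter] at hcost
  linarith

/-- A set of Kraft mass `2⁻ⁱ` containing an element of length greater than `i` splits into two
halves, and the element lies in the first one. -/
lemma exists_half_of_sum_half_pow_eq {A : Type*} [DecidableEq A] {l : A → ℕ} {S : Finset A} {i : ℕ}
    (hS : ∑ a ∈ S, (1 / 2 : ℝ) ^ l a = (1 / 2) ^ i) {a : A} (ha : a ∈ S) (hla : i < l a) :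
    ∃ T ⊆ S, a ∈ T ∧ ∑ b ∈ T, (1 / 2 : ℝ) ^ l b = (1 / 2) ^ (i + 1) ∧
      ∑ b ∈ S \ T, (1 / 2 : ℝ) ^ l b = (1 / 2) ^ (i + 1) := by
  have hlen : ∀ b ∈ S, i + 1 ≤ l b := by
    intro b hb
    by_contra! hlb
    have hab : a ≠ b := by
      rintro rfl
      omega
    have h1 : (1 / 2 : ℝ) ^ l a + (1 / 2) ^ l b ≤ (1 / 2) ^ i := by
      rw [← hS, ← Finset.sum_pair (f := fun b => (1 / 2 : ℝ) ^ l b) hab]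
      exact Finset.sum_le_sum_of_subset_of_nonneg
        (Finset.insert_subset ha (Finset.singleton_subset_iff.2 hb)) fun _ _ _ => by positivity
    have h2 : (1 / 2 : ℝ) ^ i ≤ (1 / 2) ^ l b :=
      pow_le_pow_of_le_one (by norm_num) (by norm_num) (by omega)
    have h3 : (0 : ℝ) < (1 / 2) ^ l a := by positivity
    linarith
  have hi : (0 : ℝ) < (1 / 2) ^ i := by positivity
  obtain ⟨T, hTS, hT⟩ := exists_subset_sum_half_pow_eq l (i + 1) S hlen (by
    rw [hS, pow_succ]
    linarith)
  have hT' : ∑ b ∈ S \ T, (1 / 2 : ℝ) ^ l b = (1 / 2) ^ (i + 1) := by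
    have := Finset.sum_sdiff (f := fun b => (1 / 2 : ℝ) ^ l b) hTS
    rw [hS, hT] at this
    rw [pow_succ] at this ⊢
    linarith
  by_cases haT : a ∈ T
  · exact ⟨T, hTS, haT, hT, hT'⟩
  · refine ⟨S \ T, Finset.sdiff_subset, Finset.mem_sdiff.2 ⟨ha, haT⟩, hT', ?_⟩
    rwa [Finset.sdiff_sdiff_eq_self hTS]

/-- In an optimal length function, below a set of Kraft mass `2⁻ⁱ` with an element of length at
least `i + d + 1` there is a subset of Kraft mass `2⁻⁽ⁱ⁺ᵈ⁺¹⁾` lighter by a factor `φ ^ (d + 1)`. -/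
lemma exists_light_subset_aux {A : Type*} [Fintype A] {p : A → ℝ} (hp : ∀ a, 0 ≤ p a) {l : A → ℕ}
    (hl : ∑ a, (1 / 2 : ℝ) ^ l a ≤ 1)
    (hopt : ∀ l' : A → ℕ, ∑ a, (1 / 2 : ℝ) ^ l' a ≤ 1 → ∑ a, p a * l a ≤ ∑ a, p a * l' a)
    {a : A} (d i : ℕ) (S : Finset A) (hS : ∑ b ∈ S, (1 / 2 : ℝ) ^ l b = (1 / 2) ^ i)
    (ha : a ∈ S) (hla : i + d + 1 ≤ l a) :
    ∃ T ⊆ S, ∃ U ⊆ T, ∑ b ∈ T, (1 / 2 : ℝ) ^ l b = (1 / 2) ^ (i + 1) ∧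
      ∑ b ∈ U, (1 / 2 : ℝ) ^ l b = (1 / 2) ^ (i + d + 1) ∧
      Real.goldenRatio ^ d * ∑ b ∈ U, p b ≤ ∑ b ∈ T, p b ∧
      Real.goldenRatio ^ (d + 1) * ∑ b ∈ U, p b ≤ ∑ b ∈ S, p b := by
  classical
  obtain ⟨T, hTS, haT, hT, hT'⟩ := exists_half_of_sum_half_pow_eq hS ha (by omega)
  have hsplit := Finset.sum_sdiff (f := p) hTS
  induction d generalizing i S T with
  | zero =>
    obtain ⟨U, hUS, hU, hle⟩ : ∃ U ⊆ S, ∑ b ∈ U, (1 / 2 : ℝ) ^ l b = (1 / 2) ^ (i + 1) ∧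
        2 * ∑ b ∈ U, p b ≤ ∑ b ∈ S, p b := by
      rcases le_total (∑ b ∈ T, p b) (∑ b ∈ S \ T, p b) with h | h
      · exact ⟨T, hTS, hT, by linarith⟩
      · exact ⟨S \ T, Finset.sdiff_subset, hT', by linarith⟩
    have hU0 : 0 ≤ ∑ b ∈ U, p b := Finset.sum_nonneg fun b _ => hp b
    have hφ : Real.goldenRatio * ∑ b ∈ U, p b ≤ 2 * ∑ b ∈ U, p b :=
      mul_le_mul_of_nonneg_right Real.goldenRatio_lt_two.le hU0
    exact ⟨U, hUS, U, subset_rfl, hU, hU, by simp, by simpa using hφ.trans hle⟩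
  | succ d ih =>
    obtain ⟨T₁, hT₁S, haT₁, hT₁, hT₁'⟩ := exists_half_of_sum_half_pow_eq hT haT (by omega)
    obtain ⟨V, hVT, U, hUV, hV, hU, hUV', hUT⟩ := ih (i + 1) T hT haT (by omega) T₁ hT₁S haT₁ hT₁
      hT₁' (Finset.sum_sdiff hT₁S)
    have hexch : ∑ b ∈ V, p b ≤ ∑ b ∈ S \ T, p b :=
      sum_le_sum_of_optimal hl hopt (Finset.disjoint_of_subset_right hVT Finset.sdiff_disjoint)
        hT' hV
    refine ⟨T, hTS, U, hUV.trans hVT, hT, ?_, hUT, ?_⟩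
    · rw [hU]
      congr 1
      ring
    · have hφ : Real.goldenRatio ^ (d + 1 + 1)
          = Real.goldenRatio ^ (d + 1) + Real.goldenRatio ^ d := by
        rw [pow_succ, pow_succ, mul_assoc, ← sq, Real.goldenRatio_sq]
        ring
      rw [hφ, add_mul]
      linarith

lemma exists_light_subset {A : Type*} [Fintype A] {p : A → ℝ} (hp : ∀ a, 0 ≤ p a) {l : A → ℕ}
    (hl : ∑ a, (1 / 2 : ℝ) ^ l a = 1)
    (hopt : ∀ l' : A → ℕ, ∑ a, (1 / 2 : ℝ) ^ l' a ≤ 1 → ∑ a, p a * l a ≤ ∑ a, p a * l' a)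
    {a : A} {j : ℕ} (hla : j ≤ l a) :
    ∃ U : Finset A, ∑ b ∈ U, (1 / 2 : ℝ) ^ l b = (1 / 2) ^ j ∧
      Real.goldenRatio ^ j * ∑ b ∈ U, p b ≤ ∑ b, p b := by
  cases j with
  | zero => exact ⟨Finset.univ, by simpa using hl, by simp⟩
  | succ d =>
    obtain ⟨T, -, U, -, -, hU, -, hle⟩ := exists_light_subset_aux hp hl.le hopt d 0 Finset.univ
      (by simpa using hl) (Finset.mem_univ a) (by omega)
    exact ⟨U, by simpa using hU, hle⟩

/-- An optimal length function can be truncated at length `j + m + 1`, where the alphabet has at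
most `2 ^ m` elements, at the expense of at most `φ⁻ʲ`. -/
lemma exists_bounded_lengths {A : Type*} [Fintype A] {p : A → ℝ} (hp : ∀ a, 0 ≤ p a)
    (hp1 : ∑ a, p a = 1) {l : A → ℕ} (hl : ∑ a, (1 / 2 : ℝ) ^ l a = 1)
    (hopt : ∀ l' : A → ℕ, ∑ a, (1 / 2 : ℝ) ^ l' a ≤ 1 → ∑ a, p a * l a ≤ ∑ a, p a * l' a)
    {m : ℕ} (hm : Fintype.card A ≤ 2 ^ m) (j : ℕ) :
    ∃ l' : A → ℕ, ∑ a, (1 / 2 : ℝ) ^ l' a ≤ 1 ∧ (∀ a, l' a ≤ j + m + 1) ∧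
      ∑ a, p a * l' a ≤ ∑ a, p a * l a + (Real.goldenRatio ^ j)⁻¹ := by
  classical
  have hφ : 0 < Real.goldenRatio ^ j := pow_pos Real.goldenRatio_pos j
  by_cases hshort : ∀ a, l a ≤ j + m + 1
  · exact ⟨l, hl.le, hshort, le_add_of_nonneg_right (inv_nonneg.2 hφ.le)⟩
  push Not at hshort
  obtain ⟨a, ha⟩ := hshort
  obtain ⟨U, hU, hle⟩ := exists_light_subset hp hl hopt (a := a) (j := j) (by omega)
  rw [hp1] at hle
  refine ⟨fun b => min (l b + if b ∈ U then 1 else 0) (j + m + 1), ?_,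
    fun b => min_le_right _ _, ?_⟩
  · have h : ∀ b, (1 / 2 : ℝ) ^ min (l b + if b ∈ U then 1 else 0) (j + m + 1) ≤
        (1 / 2) ^ l b - (if b ∈ U then (1 / 2) ^ l b else 0) / 2 + (1 / 2) ^ (j + m + 1) := by
      intro b
      have h1 : (1 / 2 : ℝ) ^ (l b + if b ∈ U then 1 else 0) =
          (1 / 2) ^ l b - (if b ∈ U then (1 / 2) ^ l b else 0) / 2 := by
        split_ifs
        · rw [pow_succ]
          ring
        · simp
      have h2 : (0 : ℝ) < (1 / 2) ^ (l b + if b ∈ U then 1 else 0) := by positivity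
      have h3 : (0 : ℝ) < (1 / 2) ^ (j + m + 1) := by positivity
      rw [← h1]
      rcases min_choice (l b + if b ∈ U then 1 else 0) (j + m + 1) with h | h <;> rw [h] <;>
        linarith
    refine (Finset.sum_le_sum fun b _ => h b).trans ?_
    rw [Finset.sum_add_distrib, Finset.sum_sub_distrib, ← Finset.sum_div, Finset.sum_ite_mem,
      Finset.univ_inter, hU, hl, Finset.sum_const, Finset.card_univ, nsmul_eq_mul]
    have hcard : (Fintype.card A : ℝ) * (1 / 2) ^ (j + m + 1) ≤ 2 ^ m * (1 / 2) ^ (j + m + 1) :=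
      mul_le_mul_of_nonneg_right (by exact_mod_cast hm) (by positivity)
    have hpow : (2 : ℝ) ^ m * (1 / 2) ^ (j + m + 1) = (1 / 2) ^ j / 2 := by
      have : (2 : ℝ) ^ m * (1 / 2) ^ m = 1 := by
        rw [← mul_pow]
        norm_num
      calc (2 : ℝ) ^ m * (1 / 2) ^ (j + m + 1) = (2 ^ m * (1 / 2) ^ m) * (1 / 2) ^ j / 2 := by ring
        _ = _ := by rw [this, one_mul]
    linarith
  · have h : ∀ b, p b * ((min (l b + if b ∈ U then 1 else 0) (j + m + 1) : ℕ) : ℝ) ≤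
        p b * l b + if b ∈ U then p b else 0 := by
      intro b
      have h1 : ((min (l b + if b ∈ U then 1 else 0) (j + m + 1) : ℕ) : ℝ) ≤
          l b + if b ∈ U then 1 else 0 := by
        exact_mod_cast min_le_left _ _
      refine (mul_le_mul_of_nonneg_left h1 (hp b)).trans_eq ?_
      split_ifs <;> ring
    refine (Finset.sum_le_sum fun b _ => h b).trans ?_
    rw [Finset.sum_add_distrib, Finset.sum_ite_mem, Finset.univ_inter]
    gcongr
    rwa [← one_div, le_div_iff₀' hφ]

theorem stmt2 {A : Type*} [Fintype A] (n : ℕ) (hn : 2 ≤ n) (hcard : Fintype.card A = n)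
    (p : A → ℝ) (hp0 : ∀ a, 0 ≤ p a) (hp1 : ∑ a, p a = 1)
    (L : ℤ) (hL : ⌈Real.logb 2 n⌉ + 1 ≤ L) :
    ∃ C : A → List Bool, IsPrefixCode C ∧
      (∀ a, ((C a).length : ℤ) ≤ L) ∧
      (∀ ψ : A → List Bool, IsPrefixCode ψ →
        expLen p C ≤ expLen p ψ + ((1 + Real.sqrt 5) / 2) ^ (-(L - ⌈Real.logb 2 n⌉ - 1))) := by
  have hclog : ⌈Real.logb 2 n⌉ = (Nat.clog 2 n : ℤ) := by
    have h := Real.ceil_logb_natCast (b := 2) (r := (n : ℝ)) (Nat.cast_nonneg n)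
    rw [Int.clog_natCast] at h
    exact_mod_cast h
  rw [hclog] at hL ⊢
  obtain ⟨j, hj⟩ := Int.eq_ofNat_of_zero_le (sub_nonneg.2 hL)
  have hLj : L = ((j + Nat.clog 2 n + 1 : ℕ) : ℤ) := by
    push_cast
    omega
  have : Nonempty A := Fintype.card_pos_iff.1 (by omega)
  obtain ⟨l, hl, hopt⟩ := exists_optimal_lengths p hp0
  obtain ⟨l', hl', hbound, hcost⟩ := exists_bounded_lengths hp0 hp1 hl hopt
    (hcard.trans_le (Nat.le_pow_clog one_lt_two n)) j
  obtain ⟨C, hC, hlen⟩ := exists_isPrefixCode_of_kraft l' hl'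
  refine ⟨C, hC, fun a => ?_, fun ψ hψ => ?_⟩
  · rw [hlen, hLj]
    exact_mod_cast hbound a
  · have hexp : -(L - (Nat.clog 2 n : ℤ) - 1) = -(j : ℤ) := by omega
    rw [hexp, zpow_neg, zpow_natCast]
    have hψ' := hopt (fun a => (ψ a).length) hψ.kraft
    simp only [expLen, hlen]
    have hφ : Real.goldenRatio = (1 + Real.sqrt 5) / 2 := rfl
    rw [← hφ]
    linarith
end

section
/- For every real constant c > 1, every finite alphabet A of size n ≥ 2, and every probability distribution p on A, setting L = ⌈log₂ n⌉ + ⌈1/(c−1)⌉ + 1, there exists a binary prefix code C on A such that: (i) for every binary prefix code ψ on A, the expected codeword length of C under p is at most c times the expected codeword length of ψ under p; and (ii) the number of characters a ∈ A with |C a| ≠ L + 1 is at most 2^{⌊L/c⌋+3}. -/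
namespace IsPrefixCode

variable {A : Type*} {C : A → List Bool}

theorem eq_of_prefix_apply (hC : IsPrefixCode C) {a b : A} (h : C a <+: C b) : a = b := by
  by_contra hab
  exact hC.2 a b hab h

theorem ne_nil [Nontrivial A] (hC : IsPrefixCode C) (a : A) : C a ≠ [] := by
  intro h
  obtain ⟨b, hb⟩ := exists_ne a
  exact hC.2 a b hb.symm (h ▸ List.nil_prefix)

theorem uniquelyDecodable [Nontrivial A] (hC : IsPrefixCode C) :
    InformationTheory.UniquelyDecodable (Set.range C) := by
  intro L₁
  induction L₁ with
  | nil =>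
    intro L₂ _ h₂ h
    cases L₂ with
    | nil => rfl
    | cons v L₂ =>
      obtain ⟨b, rfl⟩ := h₂ v (by simp)
      have := hC.ne_nil b
      simp_all
  | cons u L₁ ih =>
    intro L₂ h₁ h₂ h
    obtain ⟨a, rfl⟩ := h₁ u (by simp)
    cases L₂ with
    | nil =>
      have := hC.ne_nil a
      simp_all
    | cons v L₂ =>
      obtain ⟨b, rfl⟩ := h₂ v (by simp)
      have hpre₁ : C a <+: (C b :: L₂).flatten := h ▸ ⟨L₁.flatten, by simp⟩
      have hpre₂ : C b <+: (C b :: L₂).flatten := ⟨L₂.flatten, by simp⟩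
      have hab : a = b := by
        rcases le_total (C a).length (C b).length with hle | hle
        · exact hC.eq_of_prefix_apply (List.prefix_of_prefix_length_le hpre₁ hpre₂ hle)
        · exact (hC.eq_of_prefix_apply (List.prefix_of_prefix_length_le hpre₂ hpre₁ hle)).symm
      subst hab
      rw [ih L₂ (fun w hw => h₁ w (by simp [hw])) (fun w hw => h₂ w (by simp [hw]))
        (by simpa using h)]

/-- Kraft's inequality for binary prefix codes. -/
theorem kraft_s4 [Fintype A] [Nontrivial A] (hC : IsPrefixCode C) :
    ∑ a, (1 / 2 : ℝ) ^ (C a).length ≤ 1 := by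
  have h := InformationTheory.kraft_mcmillan_inequality (S := Finset.univ.map ⟨C, hC.1⟩)
    (by simpa using hC.uniquelyDecodable)
  simpa using h

end IsPrefixCode

theorem exists_not_prefix_of_length_le {A : Type*} (C : A → List Bool) (s : Finset A)
    (N : ℕ) (hlen : ∀ b ∈ s, (C b).length ≤ N) (h : ∑ b ∈ s, (1 / 2 : ℝ) ^ (C b).length < 1) :
    ∃ w : List Bool, w.length = N ∧ ∀ b ∈ s, ¬ C b <+: w := by
  classical
  let W : ℕ → Finset (List Bool) := fun M =>
    (Finset.univ : Finset (Fin M → Bool)).map ⟨List.ofFn, List.ofFn_injective⟩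
  have hW : ∀ M, (W M).card = 2 ^ M := fun M => by simp [W]
  have mem_W : ∀ w : List Bool, w ∈ W w.length := fun w => by
    simp only [W, Finset.mem_map, Finset.mem_univ, true_and, Function.Embedding.coeFn_mk]
    exact ⟨w.get, List.ofFn_get w⟩
  by_contra! hcon
  have hsub : W N ⊆ s.biUnion fun b => (W (N - (C b).length)).image (C b ++ ·) := by
    intro w hw
    have hwN : w.length = N := by
      simp only [W, Finset.mem_map, Finset.mem_univ, true_and, Function.Embedding.coeFn_mk] at hw
      obtain ⟨f, rfl⟩ := hw
      simp
    obtain ⟨b, hb, t, rfl⟩ := hcon w hwN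
    have ht : N - (C b).length = t.length := by
      rw [← hwN, List.length_append]
      omega
    exact Finset.mem_biUnion.2 ⟨b, hb, Finset.mem_image.2 ⟨t, ht ▸ mem_W t, rfl⟩⟩
  have hcard : (2 : ℕ) ^ N ≤ ∑ b ∈ s, 2 ^ (N - (C b).length) := by
    rw [← hW N]
    refine (Finset.card_le_card hsub).trans (Finset.card_biUnion_le.trans ?_)
    exact Finset.sum_le_sum fun b _ => Finset.card_image_le.trans (hW _).le
  have hcard' : (2 : ℝ) ^ N ≤ ∑ b ∈ s, (2 : ℝ) ^ (N - (C b).length) := by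
    exact_mod_cast hcard
  have hsum : ∑ b ∈ s, (2 : ℝ) ^ (N - (C b).length)
      = 2 ^ N * ∑ b ∈ s, (1 / 2 : ℝ) ^ (C b).length := by
    rw [Finset.mul_sum]
    refine Finset.sum_congr rfl fun b hb => ?_
    rw [pow_sub₀ _ two_ne_zero (hlen b hb), one_div, inv_pow]
  rw [hsum] at hcard'
  have hpos : (0 : ℝ) < 2 ^ N := by positivity
  nlinarith

/-- The converse of Kraft's inequality. -/
theorem exists_isPrefixCode_length_eq {A : Type*} [Fintype A] (g : A → ℕ)
    (h : ∑ a, (1 / 2 : ℝ) ^ g a ≤ 1) :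
    ∃ C : A → List Bool, IsPrefixCode C ∧ ∀ a, (C a).length = g a := by
  classical
  suffices key : ∀ s : Finset A, ∃ C : A → List Bool, (∀ a ∈ s, (C a).length = g a) ∧
      ∀ a ∈ s, ∀ b ∈ s, a ≠ b → ¬ C a <+: C b by
    obtain ⟨C, hlen, hC⟩ := key Finset.univ
    refine ⟨C, ⟨fun a b hab => ?_, fun a b => hC a (by simp) b (by simp)⟩,
      fun a => hlen a (by simp)⟩
    by_contra hne
    exact hC a (by simp) b (by simp) hne (hab ▸ List.prefix_rfl)
  intro s
  induction s using Finset.induction_on_max_value g with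
  | empty => exact ⟨fun _ => [], by simp, by simp⟩
  | insert a s ha hmax ih =>
    obtain ⟨C, hlen, hC⟩ := ih
    have hlt : ∑ b ∈ s, (1 / 2 : ℝ) ^ (C b).length < 1 := by
      rw [Finset.sum_congr rfl fun b hb => by rw [hlen b hb]]
      have hle : ∑ b ∈ insert a s, (1 / 2 : ℝ) ^ g b ≤ ∑ b, (1 / 2 : ℝ) ^ g b :=
        Finset.sum_le_univ_sum_of_nonneg fun b => by positivity
      rw [Finset.sum_insert ha] at hle
      have hpos : (0 : ℝ) < (1 / 2) ^ g a := by positivity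
      linarith
    obtain ⟨w, hw, hnot⟩ := exists_not_prefix_of_length_le C s (g a)
      (fun b hb => (hlen b hb).trans_le (hmax b hb)) hlt
    have hupd : ∀ b ∈ s, Function.update C a w b = C b := fun b hb =>
      Function.update_of_ne (by rintro rfl; exact ha hb) _ _
    refine ⟨Function.update C a w, ?_, ?_⟩
    · intro b hb
      rcases Finset.mem_insert.1 hb with rfl | hb
      · simpa using hw
      · rw [hupd b hb, hlen b hb]
    · intro b hb d hd hne hpre
      rcases Finset.mem_insert.1 hb with rfl | hbs <;>
        rcases Finset.mem_insert.1 hd with rfl | hds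
      · exact hne rfl
      · rw [Function.update_self, hupd d hds] at hpre
        have heq : w = C d := hpre.eq_of_length_le (by rw [hw, hlen d hds]; exact hmax d hds)
        exact hnot d hds (heq ▸ List.prefix_rfl)
      · rw [Function.update_self, hupd b hbs] at hpre
        exact hnot b hbs hpre
      · rw [hupd b hbs, hupd d hds] at hpre
        exact hC b hbs d hds hne hpre

theorem sum_half_pow_add_le_one {A : Type*} (s : Finset A) (f : A → ℕ) (K : ℕ)
    (hf : ∀ a ∈ s, f a ≤ K) (h : ∑ a ∈ s, (1 / 2 : ℝ) ^ f a < 1) :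
    ∑ a ∈ s, (1 / 2 : ℝ) ^ f a + (1 / 2) ^ K ≤ 1 := by
  have hpos : (0 : ℝ) < 2 ^ K := by positivity
  have hsum : ((∑ a ∈ s, 2 ^ (K - f a) : ℕ) : ℝ) = 2 ^ K * ∑ a ∈ s, (1 / 2 : ℝ) ^ f a := by
    push_cast
    rw [Finset.mul_sum]
    refine Finset.sum_congr rfl fun a ha => ?_
    rw [pow_sub₀ _ two_ne_zero (hf a ha), one_div, inv_pow]
  have hlt : ∑ a ∈ s, 2 ^ (K - f a) < 2 ^ K := by
    have : ((∑ a ∈ s, 2 ^ (K - f a) : ℕ) : ℝ) < 2 ^ K := by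
      rw [hsum]
      nlinarith
    exact_mod_cast this
  have hle : ((∑ a ∈ s, 2 ^ (K - f a) : ℕ) : ℝ) + 1 ≤ 2 ^ K := by exact_mod_cast hlt
  rw [hsum] at hle
  have hone : (2 : ℝ) ^ K * (1 / 2) ^ K = 1 := by rw [← mul_pow]; norm_num
  nlinarith

/-- All codewords longer than `T` can be given the common length `m + k + 2` at the cost of
lengthening some of the other codewords of length at least `k` by one bit. -/
theorem IsPrefixCode.exists_flatten_long {A : Type*} [Fintype A] [Nontrivial A]
    {ψ : A → List Bool} (hψ : IsPrefixCode ψ) (k m T : ℕ) (hk : 1 ≤ k)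
    (hm : Fintype.card A ≤ 2 ^ m) :
    ∃ C : A → List Bool, IsPrefixCode C ∧
      (∀ a, T < (ψ a).length → (C a).length = m + k + 2) ∧
      ∀ a, (ψ a).length ≤ T → (C a).length = (ψ a).length ∨
        k ≤ (ψ a).length ∧ (C a).length = (ψ a).length + 1 := by
  classical
  by_cases hlong : ∀ a, (ψ a).length ≤ T
  · exact ⟨ψ, hψ, fun a ha => absurd (hlong a) (by omega), fun a _ => Or.inl rfl⟩
  push Not at hlong
  obtain ⟨a₀, ha₀⟩ := hlong
  let g : A → ℕ := fun a => if T < (ψ a).length then m + k + 2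
    else if (ψ a).length < k then (ψ a).length else (ψ a).length + 1
  suffices hg : ∑ a, (1 / 2 : ℝ) ^ g a ≤ 1 by
    obtain ⟨C, hC, hCg⟩ := exists_isPrefixCode_length_eq g hg
    refine ⟨C, hC, fun a ha => ?_, fun a ha => ?_⟩
    · simp [hCg, g, ha]
    · simp only [hCg, g]
      split_ifs <;> omega
  let S : Finset A := {a | ¬ T < (ψ a).length ∧ (ψ a).length < k}
  let R : Finset A := {a | ¬ T < (ψ a).length ∧ ¬ (ψ a).length < k}
  let U : Finset A := {a | T < (ψ a).length}
  have hsplit : ∀ f : A → ℝ, ∑ a, f a = ∑ a ∈ U, f a + (∑ a ∈ S, f a + ∑ a ∈ R, f a) := by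
    intro f
    rw [← Finset.sum_filter_add_sum_filter_not Finset.univ (fun a => T < (ψ a).length),
      ← Finset.sum_filter_add_sum_filter_not
        (Finset.univ.filter fun a => ¬ T < (ψ a).length) (fun a => (ψ a).length < k),
      Finset.filter_filter, Finset.filter_filter]
  have hkraft := hψ.kraft_s4
  rw [hsplit] at hkraft
  have hU : 0 < ∑ a ∈ U, (1 / 2 : ℝ) ^ (ψ a).length :=
    Finset.sum_pos (fun a _ => by positivity) ⟨a₀, by simp [U, ha₀]⟩
  have hR : 0 ≤ ∑ a ∈ R, (1 / 2 : ℝ) ^ (ψ a).length :=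
    Finset.sum_nonneg fun a _ => by positivity
  have hS := sum_half_pow_add_le_one S (fun a => (ψ a).length) (k - 1)
    (fun a ha => by simp only [S, Finset.mem_filter] at ha; omega) (by linarith)
  have gS : ∑ a ∈ S, (1 / 2 : ℝ) ^ g a = ∑ a ∈ S, (1 / 2 : ℝ) ^ (ψ a).length := by
    refine Finset.sum_congr rfl fun a ha => ?_
    simp only [S, Finset.mem_filter, Finset.mem_univ, true_and] at ha
    simp [g, ha]
  have gR : ∑ a ∈ R, (1 / 2 : ℝ) ^ g a = (∑ a ∈ R, (1 / 2 : ℝ) ^ (ψ a).length) * (1 / 2) := by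
    rw [Finset.sum_mul]
    refine Finset.sum_congr rfl fun a ha => ?_
    simp only [R, Finset.mem_filter, Finset.mem_univ, true_and] at ha
    rw [← pow_succ]
    simp [g, ha.1, ha.2]
  have gU : ∑ a ∈ U, (1 / 2 : ℝ) ^ g a ≤ (1 / 2) ^ (k - 1) * (1 / 8) := by
    have hconst : ∑ a ∈ U, (1 / 2 : ℝ) ^ g a = U.card * (1 / 2) ^ (m + k + 2) := by
      rw [← nsmul_eq_mul, ← Finset.sum_const]
      refine Finset.sum_congr rfl fun a ha => ?_
      simp only [U, Finset.mem_filter, Finset.mem_univ, true_and] at ha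
      simp [g, ha]
    have hcard : (U.card : ℝ) ≤ 2 ^ m := by exact_mod_cast U.card_le_univ.trans hm
    have hexp : m + k + 2 = m + (k - 1) + 3 := by omega
    have hone : (2 : ℝ) ^ m * (1 / 2) ^ m = 1 := by rw [← mul_pow]; norm_num
    rw [hconst, hexp, pow_add, pow_add]
    calc (U.card : ℝ) * ((1 / 2) ^ m * (1 / 2) ^ (k - 1) * (1 / 2) ^ 3)
        ≤ 2 ^ m * ((1 / 2) ^ m * (1 / 2) ^ (k - 1) * (1 / 2) ^ 3) := by gcongr
      _ = 2 ^ m * (1 / 2) ^ m * ((1 / 2) ^ (k - 1) * (1 / 8)) := by ring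
      _ = (1 / 2) ^ (k - 1) * (1 / 8) := by rw [hone, one_mul]
  rw [hsplit, gS, gR]
  have hk' : (0 : ℝ) < (1 / 2) ^ (k - 1) := by positivity
  linarith

theorem IsPrefixCode.card_length_le {A : Type*} [Fintype A] [Nontrivial A]
    {ψ : A → List Bool} (hψ : IsPrefixCode ψ) (T : ℕ) :
    (Finset.univ.filter fun a => (ψ a).length ≤ T).card ≤ 2 ^ T := by
  have h : ((Finset.univ.filter fun a => (ψ a).length ≤ T).card : ℝ) * (1 / 2) ^ T ≤ 1 := by
    refine le_trans ?_ hψ.kraft_s4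
    rw [← nsmul_eq_mul, ← Finset.sum_const]
    refine (Finset.sum_le_sum fun a ha => ?_).trans
      (Finset.sum_le_univ_sum_of_nonneg fun a => by positivity)
    exact pow_le_pow_of_le_one (by norm_num) (by norm_num) (Finset.mem_filter.1 ha).2
  rw [one_div, inv_pow, ← div_eq_mul_inv, div_le_one (by positivity)] at h
  exact_mod_cast h

/-- Among the codes with bounded codeword lengths satisfying `P`, one has minimal expected
length. -/
theorem exists_forall_expLen_le_of_length_le {A : Type*} [Fintype A] (p : A → ℝ)
    (P : (A → List Bool) → Prop) (M : ℕ) (hbound : ∀ C, P C → ∀ a, (C a).length ≤ M)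
    (hne : ∃ C, P C) : ∃ C, P C ∧ ∀ D, P D → expLen p C ≤ expLen p D := by
  have hfin : {C | P C}.Finite :=
    (Set.Finite.pi' fun _ : A => List.finite_length_le Bool M).subset fun C hC => hbound C hC
  exact Set.exists_min_image _ (expLen p) hfin hne

theorem stmt4 {A : Type*} [Fintype A] [DecidableEq A]
    (c : ℝ) (hc : 1 < c)
    (n : ℕ) (hn : 2 ≤ n) (hcard : Fintype.card A = n)
    (p : A → ℝ) (hp0 : ∀ a, 0 ≤ p a) (hp1 : ∑ a, p a = 1)
    (L : ℤ) (hL : L = ⌈Real.logb 2 n⌉ + ⌈1 / (c - 1)⌉ + 1) :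
    ∃ C : A → List Bool, IsPrefixCode C ∧
      (∀ ψ : A → List Bool, IsPrefixCode ψ → expLen p C ≤ c * expLen p ψ) ∧
      (((Finset.univ.filter fun a : A => ((C a).length : ℤ) ≠ L + 1).card : ℝ) ≤
        2 ^ (⌊(L : ℝ) / c⌋ + 3)) := by
  have : Nontrivial A := Fintype.one_lt_card_iff_nontrivial.1 (by omega)
  have hc0 : 0 < c - 1 := by linarith
  have hcpos : 0 < c := by linarith
  obtain ⟨k, hk⟩ : ∃ k : ℕ, ⌈1 / (c - 1)⌉ = k :=
    Int.eq_ofNat_of_zero_le (Int.ceil_nonneg (by positivity))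
  have hkc : 1 ≤ (c - 1) * k := by
    have h := Int.le_ceil (1 / (c - 1))
    rw [hk, div_le_iff₀ hc0] at h
    push_cast at h
    linarith
  have hk1 : 1 ≤ k := by
    rcases Nat.eq_zero_or_pos k with rfl | h
    · norm_num at hkc
    · exact h
  have hn0 : (0 : ℝ) < n := by exact_mod_cast (by omega : 0 < n)
  obtain ⟨m, hm⟩ : ∃ m : ℕ, ⌈Real.logb 2 n⌉ = m :=
    Int.eq_ofNat_of_zero_le (Int.ceil_nonneg
      (Real.logb_nonneg one_lt_two (by exact_mod_cast (by omega : 1 ≤ n))))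
  have hnm : Fintype.card A ≤ 2 ^ m := by
    have h := Int.le_ceil (Real.logb 2 n)
    rw [hm, Real.logb_le_iff_le_rpow one_lt_two hn0] at h
    rw [hcard]
    have h' : (n : ℝ) ≤ 2 ^ m := by simpa using h
    exact_mod_cast h'
  rw [hm, hk] at hL
  have hL0 : (0 : ℝ) ≤ L := by exact_mod_cast (by omega : 0 ≤ L)
  obtain ⟨t, ht⟩ : ∃ t : ℕ, ⌊(L : ℝ) / c⌋ = t :=
    Int.eq_ofNat_of_zero_le (Int.floor_nonneg.2 (by positivity))
  have hLt : (L : ℝ) < c * (t + 1) := by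
    have h := Int.lt_floor_add_one ((L : ℝ) / c)
    rw [ht, div_lt_iff₀ hcpos] at h
    push_cast at h
    linarith
  let P : (A → List Bool) → Prop := fun C => IsPrefixCode C ∧
    (Finset.univ.filter fun a => ((C a).length : ℤ) ≠ L + 1).card ≤ 2 ^ (t + 1) ∧
    ∀ a, (C a).length ≤ m + k + t + 2
  have key : ∀ ψ, IsPrefixCode ψ → ∃ C, P C ∧ expLen p C ≤ c * expLen p ψ := by
    intro ψ hψ
    obtain ⟨C, hC, hlong, hshort⟩ := hψ.exists_flatten_long k m (t + 1) hk1 hnm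
    refine ⟨C, ⟨hC, ?_, ?_⟩, ?_⟩
    · refine (Finset.card_le_card fun a ha => ?_).trans (hψ.card_length_le (t + 1))
      simp only [Finset.mem_filter, Finset.mem_univ, true_and] at ha ⊢
      by_contra! hlt
      have := hlong a hlt
      omega
    · intro a
      rcases lt_or_ge (t + 1) (ψ a).length with h | h
      · have := hlong a h
        omega
      · have := hshort a h
        omega
    · rw [expLen, expLen, Finset.mul_sum]
      refine Finset.sum_le_sum fun a _ => ?_
      rw [mul_left_comm]
      refine mul_le_mul_of_nonneg_left ?_ (hp0 a)
      have hlen0 : (0 : ℝ) ≤ (ψ a).length := by positivity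
      rcases lt_or_ge (t + 1) (ψ a).length with h | h
      · have hLC : ((C a).length : ℝ) = L + 1 := by
          rw [hlong a h, hL]
          push_cast
          ring
        have h' : (t : ℝ) + 2 ≤ (ψ a).length := by exact_mod_cast h
        rw [hLC]
        nlinarith
      · rcases hshort a h with h' | ⟨hka, h'⟩
        · rw [h']
          nlinarith
        · have hka' : (k : ℝ) ≤ (ψ a).length := by exact_mod_cast hka
          rw [h']
          push_cast
          nlinarith
  obtain ⟨ψ₀, hψ₀, -⟩ := exists_isPrefixCode_length_eq (fun _ : A => m) (by
    rw [Finset.sum_const, nsmul_eq_mul, one_div, inv_pow, ← div_eq_mul_inv,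
      div_le_one (by positivity)]
    exact_mod_cast hnm)
  obtain ⟨C, hC, hmin⟩ := exists_forall_expLen_le_of_length_le p P (m + k + t + 2)
    (fun C hC => hC.2.2) ((key ψ₀ hψ₀).imp fun _ h => h.1)
  refine ⟨C, hC.1, fun ψ hψ => ?_, ?_⟩
  · obtain ⟨D, hD, hle⟩ := key ψ hψ
    exact (hmin D hD).trans hle
  · rw [ht]
    have hcount := hC.2.1.trans (Nat.pow_le_pow_right two_pos (by omega : t + 1 ≤ t + 3))
    exact_mod_cast hcount
end

section
/- Let n ≥ 2 and, for a permutation π of Fin n, define L_π : Fin n → ℕ by L_π(π(i)) = i + 1 for 0 ≤ i ≤ n − 2 and L_π(π(n−1)) = n − 1 (indices 0-based, so the character π(i) gets value i+1 except that the last character also gets value n−1). Then the map sending π to the pair (L_π, the Boolean value of the comparison π(n−2) < π(n−1)) is injective on permutations of Fin n; that is, if L_π = L_σ and (π(n−2) < π(n−1) ↔ σ(n−2) < σ(n−1)), then π = σ. -/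
theorem stmt6 (n : ℕ) (hn : 2 ≤ n) (π σ : Equiv.Perm (Fin n))
    (hL : ∀ a : Fin n,
      (if (π.symm a : ℕ) = n - 1 then n - 1 else (π.symm a : ℕ) + 1) =
      (if (σ.symm a : ℕ) = n - 1 then n - 1 else (σ.symm a : ℕ) + 1))
    (hbit : π ⟨n - 2, by omega⟩ < π ⟨n - 1, by omega⟩ ↔
            σ ⟨n - 2, by omega⟩ < σ ⟨n - 1, by omega⟩) :
    π = σ := by
  have key : ∀ i : Fin n, ((σ.symm (π i) : Fin n) : ℕ) = i ∨
      (n - 2 ≤ (i : ℕ) ∧ n - 2 ≤ (σ.symm (π i) : ℕ)) := by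
    intro i
    have h := hL (π i)
    rw [Equiv.symm_apply_apply] at h
    have h₁ := i.isLt
    have h₂ := (σ.symm (π i)).isLt
    split_ifs at h <;> omega
  set p : Fin n := ⟨n - 2, by omega⟩ with hp
  set q : Fin n := ⟨n - 1, by omega⟩ with hq
  have hpq : p ≠ q := by simp only [hp, hq, ne_eq, Fin.mk.injEq]; omega
  have hcases : ∀ j : Fin n, n - 2 ≤ (j : ℕ) → j = p ∨ j = q := by
    intro j hj
    have h₁ := j.isLt
    simp only [hp, hq, Fin.ext_iff]
    omega
  have hmem : ∀ i : Fin n, n - 2 ≤ (i : ℕ) → π i = σ p ∨ π i = σ q := by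
    intro i hi
    have h : n - 2 ≤ (σ.symm (π i) : ℕ) := by
      rcases key i with h | h <;> omega
    simpa only [Equiv.symm_apply_eq] using hcases _ h
  have hP := hmem p le_rfl
  have hQ := hmem q (by simp only [hq]; omega)
  have hπ : π p ≠ π q := π.injective.ne hpq
  have hσ : σ p ≠ σ q := σ.injective.ne hpq
  have hends : π p = σ p ∧ π q = σ q := by
    rcases hP with hP | hP <;> rcases hQ with hQ | hQ
    · exact absurd (hP.trans hQ.symm) hπ
    · exact ⟨hP, hQ⟩
    · rw [hP, hQ] at hbit
      rcases lt_or_gt_of_ne hσ with h | h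
      · exact absurd (hbit.mpr h) h.asymm
      · exact absurd (hbit.mp h) h.asymm
    · exact absurd (hP.trans hQ.symm) hπ
  ext1 i
  rcases key i with h | ⟨h, -⟩
  · exact (Equiv.symm_apply_eq σ).mp (Fin.ext h)
  · rcases hcases i h with rfl | rfl
    · exact hends.1
    · exact hends.2
end

section
/- Let a : Fin s → ℕ and b : Fin t → ℕ be families of natural numbers, let n₁ = ∑_i a_i, n₂ = ∑_j b_j, and n = n₁ + n₂, and suppose n > 0. With the convention that a term x·log₂(y/x) equals 0 when x = 0, we have ∑_i a_i·log₂(n/a_i) + ∑_j b_j·log₂(n/b_j) ≤ ∑_i a_i·log₂(n₁/a_i) + ∑_j b_j·log₂(n₂/b_j) + n. -/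
/-- An entropy-style term: `x * log₂ (y / x)`, with the convention that it is `0`
when `x = 0`. -/
noncomputable def entTerm (x : ℕ) (y : ℕ) : ℝ :=
  if x = 0 then 0 else (x : ℝ) * Real.logb 2 ((y : ℝ) / (x : ℝ))

/-- Enlarging the numerator from the total to `n` costs the term of the total. -/
theorem sum_entTerm_eq_add_entTerm_sum {ι : Type*} (u : Finset ι) (a : ι → ℕ) {n : ℕ}
    (hn : 0 < n) :
    ∑ i ∈ u, entTerm (a i) n =
      (∑ i ∈ u, entTerm (a i) (∑ i ∈ u, a i)) + entTerm (∑ i ∈ u, a i) n := by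
  have key : ∀ i ∈ u, entTerm (a i) n = entTerm (a i) (∑ i ∈ u, a i) +
      a i * Real.logb 2 ((n : ℝ) / (∑ i ∈ u, a i : ℕ)) := by
    intro i hi
    have hle : a i ≤ ∑ i ∈ u, a i := Finset.single_le_sum (fun _ _ => Nat.zero_le _) hi
    generalize (∑ i ∈ u, a i) = m at hle ⊢
    by_cases h : a i = 0
    · simp [entTerm, h]
    · have hx : (a i : ℝ) ≠ 0 := by exact_mod_cast h
      have hm : (m : ℝ) ≠ 0 := by norm_cast; omega
      have hn' : (n : ℝ) ≠ 0 := by norm_cast; omega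
      simp only [entTerm, h, if_false]
      rw [Real.logb_div hn' hx, Real.logb_div hm hx, Real.logb_div hn' hm]
      ring
  rw [Finset.sum_congr rfl key, Finset.sum_add_distrib, ← Finset.sum_mul, ← Nat.cast_sum]
  congr 1
  by_cases h : ∑ i ∈ u, a i = 0
  · rw [h]
    simp [entTerm]
  · rw [entTerm, if_neg h]

theorem entTerm_add_entTerm_le (m k : ℕ) :
    entTerm m (m + k) + entTerm k (m + k) ≤ (m + k : ℕ) := by
  rcases Nat.eq_zero_or_pos (m + k) with h | h
  · obtain ⟨rfl, rfl⟩ : m = 0 ∧ k = 0 := by omega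
    simp [entTerm]
  have hn : (0 : ℝ) < (m : ℝ) + k := by exact_mod_cast h
  have hlog : 0 < Real.log 2 := Real.log_pos one_lt_two
  have hent (x : ℕ) : entTerm x (m + k) =
      x * Real.log (((m : ℝ) + k) / x) / Real.log 2 := by
    by_cases hx : x = 0
    · simp [entTerm, hx]
    · simp only [entTerm, if_neg hx, Real.logb]
      push_cast
      ring
  have hk : 1 - (m : ℝ) / (m + k) = k / (m + k) := by field_simp; ring
  have hbin := Real.binEntropy_le_log_two (p := (m : ℝ) / (m + k))
  rw [Real.binEntropy, hk, inv_div, inv_div, div_mul_eq_mul_div, div_mul_eq_mul_div,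
    ← add_div, div_le_iff₀ hn] at hbin
  rw [hent, hent, ← add_div, div_le_iff₀ hlog]
  push_cast
  linarith

theorem stmt9 (s t : ℕ) (a : Fin s → ℕ) (b : Fin t → ℕ)
    (n₁ n₂ n : ℕ) (hn₁ : n₁ = ∑ i, a i) (hn₂ : n₂ = ∑ j, b j)
    (hn : n = n₁ + n₂) (hpos : 0 < n) :
    (∑ i, entTerm (a i) n) + (∑ j, entTerm (b j) n) ≤
      (∑ i, entTerm (a i) n₁) + (∑ j, entTerm (b j) n₂) + n := by
  have ha := sum_entTerm_eq_add_entTerm_sum Finset.univ a hpos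
  have hb := sum_entTerm_eq_add_entTerm_sum Finset.univ b hpos
  have hle := entTerm_add_entTerm_le n₁ n₂
  rw [← hn₁] at ha
  rw [← hn₂] at hb
  rw [← hn] at hle
  linarith
end

section
/- Let k and L be integers with L ≥ k ≥ 1, and let m : {1, …, L} → ℕ be counts with n = ∑_{ℓ=1}^{L} m_ℓ. Suppose that m_ℓ ≤ 2^ℓ for every ℓ with 1 ≤ ℓ ≤ k, and that 2^{k−1} < n ≤ 2^k. Then, with the convention that a term x·log₂(n/x) equals 0 when x = 0, ∑_{ℓ=1}^{L} m_ℓ·log₂(n/m_ℓ) ≤ n·log₂(L − k + 1) + 9n. -/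
theorem entTerm_le (x n : ℕ) (hn : 0 < n) {q : ℝ} (hq : 0 < q) :
    entTerm x n ≤ x * -Real.logb 2 q + 2 * (n * q) := by
  have hn' : (0 : ℝ) < n := by exact_mod_cast hn
  unfold entTerm
  split_ifs with hx
  · subst hx
    simp only [Nat.cast_zero, zero_mul, zero_add]
    positivity
  · have hx' : (0 : ℝ) < x := by exact_mod_cast Nat.pos_of_ne_zero hx
    have hlog2 : (1 / 2 : ℝ) < Real.log 2 := by linarith [Real.log_two_gt_d9]
    have hsplit : Real.logb 2 ((n : ℝ) / x) = -Real.logb 2 q + Real.logb 2 (n * q / x) := by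
      rw [mul_div_right_comm, Real.logb_mul (by positivity) hq.ne']
      ring
    have htangent : Real.logb 2 (n * q / x) ≤ 2 * (n * q / x) := by
      have hpos : 0 < n * q / x := by positivity
      rw [Real.logb, div_le_iff₀ (by linarith)]
      nlinarith [Real.log_le_sub_one_of_pos hpos]
    calc (x : ℝ) * Real.logb 2 ((n : ℝ) / x)
        = x * -Real.logb 2 q + x * Real.logb 2 (n * q / x) := by rw [hsplit]; ring
      _ ≤ x * -Real.logb 2 q + x * (2 * (n * q / x)) := by gcongr
      _ = x * -Real.logb 2 q + 2 * (n * q) := by field_simp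

theorem sum_range_two_pow (k : ℕ) :
    ∑ l ∈ Finset.range k, (2 : ℝ) ^ l = 2 ^ k - 1 := by
  rw [geom_sum_eq (by norm_num)]
  norm_num

theorem sum_range_two_pow_mul_sub (k : ℕ) :
    ∑ l ∈ Finset.range k, (2 : ℝ) ^ l * ((k : ℝ) - l) = 2 * 2 ^ k - k - 2 := by
  induction k with
  | zero => norm_num
  | succ k ih =>
    have hstep : ∀ l : ℕ, (2 : ℝ) ^ l * (((k + 1 : ℕ) : ℝ) - l) =
        2 ^ l * ((k : ℝ) - l) + 2 ^ l := fun l => by push_cast; ring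
    simp only [hstep, Finset.sum_add_distrib]
    rw [Finset.sum_range_succ, ih, sum_range_two_pow]
    push_cast
    ring

theorem stmt13 (k L : ℕ) (hk : 1 ≤ k) (hkL : k ≤ L)
    (m : ℕ → ℕ) (n : ℕ) (hn : n = ∑ ℓ ∈ Finset.Icc 1 L, m ℓ)
    (hm : ∀ ℓ, 1 ≤ ℓ → ℓ ≤ k → m ℓ ≤ 2 ^ ℓ)
    (hn₁ : 2 ^ (k - 1) < n) (hn₂ : n ≤ 2 ^ k) :
    ∑ ℓ ∈ Finset.Icc 1 L, entTerm (m ℓ) n ≤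
      (n : ℝ) * Real.logb 2 (L - k + 1) + 9 * n := by
  have hn0 : 0 < n := Nat.zero_lt_of_lt hn₁
  have hkL' : (k : ℝ) ≤ L := by exact_mod_cast hkL
  have hpow : (2 : ℝ) ^ k ≤ 2 * n := by
    have : 2 ^ k ≤ 2 * n := by
      obtain ⟨j, rfl⟩ := Nat.exists_eq_add_of_le' hk
      simp only [Nat.add_sub_cancel] at hn₁
      rw [pow_succ]
      omega
    exact_mod_cast this
  have hIcc : Finset.Icc 1 L = Finset.Ico 1 k ∪ Finset.Icc k L := by
    ext l
    simp only [Finset.mem_union, Finset.mem_Icc, Finset.mem_Ico]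
    omega
  have hdisj : Disjoint (Finset.Ico 1 k) (Finset.Icc k L) := by
    rw [Finset.disjoint_left]
    intro l
    simp only [Finset.mem_Icc, Finset.mem_Ico]
    omega
  have hshort : ∑ l ∈ Finset.Ico 1 k, entTerm (m l) n ≤ 6 * n := by
    calc ∑ l ∈ Finset.Ico 1 k, entTerm (m l) n
        ≤ ∑ l ∈ Finset.Ico 1 k,
            ((2 : ℝ) ^ l * ((k : ℝ) - l) + 2 * n / 2 ^ k * 2 ^ l) := by
          refine Finset.sum_le_sum fun l hl => ?_
          obtain ⟨hl1, hlk⟩ := Finset.mem_Ico.mp hl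
          have hlk' : (l : ℝ) ≤ k := by exact_mod_cast hlk.le
          have hml : (m l : ℝ) ≤ 2 ^ l := by exact_mod_cast hm l hl1 hlk.le
          have hlog : -Real.logb 2 ((2 : ℝ) ^ l / 2 ^ k) = k - l := by
            rw [Real.logb_div (by positivity) (by positivity), Real.logb_pow, Real.logb_pow,
              Real.logb_self_eq_one (by norm_num)]
            ring
          have h := entTerm_le (m l) n hn0 (q := (2 : ℝ) ^ l / 2 ^ k) (by positivity)
          rw [hlog] at h
          calc entTerm (m l) n ≤ _ := h
            _ ≤ 2 ^ l * ((k : ℝ) - l) + 2 * (n * (2 ^ l / 2 ^ k)) := by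
              gcongr
            _ = _ := by ring
      _ ≤ ∑ l ∈ Finset.range k,
            ((2 : ℝ) ^ l * ((k : ℝ) - l) + 2 * n / 2 ^ k * 2 ^ l) := by
          refine Finset.sum_le_sum_of_subset_of_nonneg ?_ fun l hl _ => ?_
          · intro l hl
            exact Finset.mem_range.mpr (Finset.mem_Ico.mp hl).2
          · have hlk : (0 : ℝ) ≤ k - l :=
              sub_nonneg.mpr (by exact_mod_cast (Finset.mem_range.mp hl).le)
            positivity
      _ = 2 * 2 ^ k - k - 2 + 2 * n / 2 ^ k * (2 ^ k - 1) := by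
          rw [Finset.sum_add_distrib, ← Finset.mul_sum, sum_range_two_pow,
            sum_range_two_pow_mul_sub]
      _ ≤ 2 * 2 ^ k + 2 * n / 2 ^ k * 2 ^ k := by
          have h₁ : (0 : ℝ) ≤ 2 * n / 2 ^ k := by positivity
          have h₂ : (0 : ℝ) ≤ k := by positivity
          linarith
      _ = 2 * 2 ^ k + 2 * n := by rw [div_mul_cancel₀ _ (by positivity)]
      _ ≤ 6 * n := by linarith
  have hlong : ∑ l ∈ Finset.Icc k L, entTerm (m l) n ≤
      n * Real.logb 2 (L - k + 1) + 2 * n := by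
    have hD : (1 : ℝ) ≤ L - k + 1 := by linarith
    have hcard : ((Finset.Icc k L).card : ℝ) = L - k + 1 := by
      rw [Nat.card_Icc, Nat.cast_sub (by omega)]
      push_cast
      ring
    have hsum : ∑ l ∈ Finset.Icc k L, (m l : ℝ) ≤ n := by
      have : ∑ l ∈ Finset.Icc k L, m l ≤ n := by
        rw [hn]
        exact Finset.sum_le_sum_of_subset (Finset.Icc_subset_Icc_left hk)
      exact_mod_cast this
    calc ∑ l ∈ Finset.Icc k L, entTerm (m l) n
        ≤ ∑ l ∈ Finset.Icc k L, ((m l : ℝ) * Real.logb 2 (L - k + 1) +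
            2 * (n * ((L : ℝ) - k + 1)⁻¹)) := by
          refine Finset.sum_le_sum fun l _ => ?_
          have h := entTerm_le (m l) n hn0 (q := ((L : ℝ) - k + 1)⁻¹) (by positivity)
          rwa [Real.logb_inv, neg_neg] at h
      _ = (∑ l ∈ Finset.Icc k L, (m l : ℝ)) * Real.logb 2 (L - k + 1) + 2 * n := by
          rw [Finset.sum_add_distrib, ← Finset.sum_mul, Finset.sum_const, nsmul_eq_mul, hcard]
          have : (L : ℝ) - k + 1 ≠ 0 := by linarith
          field_simp
      _ ≤ n * Real.logb 2 (L - k + 1) + 2 * n := by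
          have := Real.logb_nonneg (b := 2) (by norm_num) hD
          gcongr
  rw [hIcc, Finset.sum_union hdisj]
  have : (0 : ℝ) ≤ n := by positivity
  linarith
end
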